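/- The polynomials f₈(Z₁,Z₂) = Z₁⁸ + 14Z₁⁴Z₂⁴ + Z₂⁸, f₆(Z₁,Z₂)² where f₆ = Z₁Z₂(Z₁⁴ − Z₂⁴), and the product f₆·f₁₂ where f₁₂(Z₁,Z₂) = Z₁¹² − 33Z₁⁸Z₂⁴ − 33Z₁⁴Z₂⁸ + Z₂¹², are each invariant under the binary octahedral group ⟨σ₈, τ, μ⟩ ≤ SL₂(ℂ): for every g in this group and every (z₁, z₂) ∈ ℂ², each of these polynomials takes the same value at g·(z₁, z₂) as at (z₁, z₂). -/

import Mathlib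

noncomputable section

open Complex Matrix MvPolynomial

/-- `SL₂(ℂ)`. -/
abbrev SL2 : Type := Matrix.SpecialLinearGroup (Fin 2) ℂ

/-- `ω N = exp(2πi/N)`. -/
def ω (N : ℕ) : ℂ := Complex.exp (2 * Real.pi * Complex.I / N)

/-- `σ N = [[ω_N, 0],[0, ω_N⁻¹]] ∈ SL₂(ℂ)`. -/
def σ (N : ℕ) : SL2 :=
  ⟨!![ω N, 0; 0, (ω N)⁻¹], by
    have h : ω N ≠ 0 := Complex.exp_ne_zero _
    simp [Matrix.det_fin_two_of, mul_inv_cancel₀ h]⟩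

/-- `τ = [[0,1],[−1,0]] ∈ SL₂(ℂ)`. -/
def τ : SL2 :=
  ⟨!![0, 1; -1, 0], by simp [Matrix.det_fin_two_of]⟩

lemma ω_eight_pow_eight : ω 8 ^ 8 = 1 := by
  rw [ω, ← Complex.exp_nat_mul]
  rw [show ((8 : ℕ) : ℂ) * (2 * Real.pi * Complex.I / ((8:ℕ) : ℂ)) = 2 * Real.pi * Complex.I by
    push_cast; ring]
  exact Complex.exp_two_pi_mul_I

lemma ω_eight_pow_four : ω 8 ^ 4 = -1 := by
  rw [ω, ← Complex.exp_nat_mul]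
  rw [show ((4 : ℕ) : ℂ) * (2 * Real.pi * Complex.I / ((8:ℕ) : ℂ)) = Real.pi * Complex.I by
    push_cast; ring]
  exact Complex.exp_pi_mul_I

/-- `μ = (1/√2)·[[ω₈⁷, ω₈⁷],[ω₈⁵, ω₈]] ∈ SL₂(ℂ)`. -/
def μ : SL2 :=
  ⟨(Real.sqrt 2 : ℂ)⁻¹ • !![ω 8 ^ 7, ω 8 ^ 7; ω 8 ^ 5, ω 8], by
    have h2 : ((Real.sqrt 2 : ℂ))^2 = 2 := by
      rw [← Complex.ofReal_pow, Real.sq_sqrt (by norm_num : (2:ℝ) ≥ 0)]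
      norm_num
    have hdet : Matrix.det !![ω 8 ^ 7, ω 8 ^ 7; ω 8 ^ 5, ω 8] = 2 := by
      rw [Matrix.det_fin_two_of]
      linear_combination 2 * ω_eight_pow_eight - ω 8 ^ 8 * ω_eight_pow_four
    have hs : (Real.sqrt 2 : ℂ) ≠ 0 := by
      simpa using Real.sqrt_ne_zero'.mpr (by norm_num : (0:ℝ) < 2)
    rw [Matrix.det_smul, hdet]
    rw [show (Fintype.card (Fin 2)) = 2 from rfl]
    field_simp
    exact h2.symm⟩

/-- `f₆ = Z₁Z₂(Z₁⁴ − Z₂⁴)`. -/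
def f6 : MvPolynomial (Fin 2) ℂ :=
  MvPolynomial.X 0 * MvPolynomial.X 1 * ((MvPolynomial.X 0) ^ 4 - (MvPolynomial.X 1) ^ 4)

/-- `f₈ = Z₁⁸ + 14Z₁⁴Z₂⁴ + Z₂⁸`. -/
def f8 : MvPolynomial (Fin 2) ℂ :=
  (MvPolynomial.X 0) ^ 8 + 14 * (MvPolynomial.X 0) ^ 4 * (MvPolynomial.X 1) ^ 4
    + (MvPolynomial.X 1) ^ 8

/-- `f₁₂ = Z₁¹² − 33Z₁⁸Z₂⁴ − 33Z₁⁴Z₂⁸ + Z₂¹²`. -/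
def f12 : MvPolynomial (Fin 2) ℂ :=
  (MvPolynomial.X 0) ^ 12 - 33 * (MvPolynomial.X 0) ^ 8 * (MvPolynomial.X 1) ^ 4
    - 33 * (MvPolynomial.X 0) ^ 4 * (MvPolynomial.X 1) ^ 8 + (MvPolynomial.X 1) ^ 12

/-- A polynomial whose values are preserved by a set of matrices in `SL₂(ℂ)` has its values
preserved by the subgroup they generate. -/
lemma eval_mulVec_eq_of_mem_closure {S : Set SL2} {p : MvPolynomial (Fin 2) ℂ}
    (hS : ∀ s ∈ S, ∀ z : Fin 2 → ℂ,
      eval ((s : Matrix (Fin 2) (Fin 2) ℂ) *ᵥ z) p = eval z p)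
    {g : SL2} (hg : g ∈ Subgroup.closure S) (z : Fin 2 → ℂ) :
    eval ((g : Matrix (Fin 2) (Fin 2) ℂ) *ᵥ z) p = eval z p := by
  induction hg using Subgroup.closure_induction generalizing z with
  | mem s hs => exact hS s hs z
  | one => simp
  | mul a b _ _ ha hb =>
    rw [Matrix.SpecialLinearGroup.coe_mul, ← Matrix.mulVec_mulVec, ha, hb]
  | inv a _ ha =>
    rw [← ha, Matrix.mulVec_mulVec, ← Matrix.SpecialLinearGroup.coe_mul, mul_inv_cancel,
      Matrix.SpecialLinearGroup.coe_one, Matrix.one_mulVec]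

lemma eval_f6 (z : Fin 2 → ℂ) : eval z f6 = z 0 * z 1 * (z 0 ^ 4 - z 1 ^ 4) := by
  simp [f6]

lemma eval_f8 (z : Fin 2 → ℂ) : eval z f8 = z 0 ^ 8 + 14 * z 0 ^ 4 * z 1 ^ 4 + z 1 ^ 8 := by
  simp [f8]

lemma eval_f12 (z : Fin 2 → ℂ) :
    eval z f12 =
      z 0 ^ 12 - 33 * z 0 ^ 8 * z 1 ^ 4 - 33 * z 0 ^ 4 * z 1 ^ 8 + z 1 ^ 12 := by
  simp [f12]

lemma σ_mulVec (N : ℕ) (z : Fin 2 → ℂ) :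
    (σ N : Matrix (Fin 2) (Fin 2) ℂ) *ᵥ z = ![ω N * z 0, (ω N)⁻¹ * z 1] := by
  ext i
  fin_cases i <;> simp [σ, Matrix.mulVec, dotProduct]

lemma τ_mulVec (z : Fin 2 → ℂ) :
    (τ : Matrix (Fin 2) (Fin 2) ℂ) *ᵥ z = ![z 1, -z 0] := by
  ext i
  fin_cases i <;> simp [τ, Matrix.mulVec, dotProduct]

/-- Up to the scalars `a` and `c`, the matrix `μ` acts by `(z₁, z₂) ↦ (z₁ + z₂, z₁ - z₂)`. -/
lemma exists_μ_mulVec :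
    ∃ a c : ℂ, a ^ 4 = -1 / 4 ∧ c ^ 4 = -1 / 4 ∧ a * c = -1 / 2 ∧
      ∀ z : Fin 2 → ℂ,
        (μ : Matrix (Fin 2) (Fin 2) ℂ) *ᵥ z = ![a * (z 0 + z 1), c * (z 0 - z 1)] := by
  have hs : ((Real.sqrt 2 : ℂ)⁻¹) ^ 2 = 1 / 2 := by
    rw [inv_pow, ← Complex.ofReal_pow, Real.sq_sqrt zero_le_two]
    norm_num
  have hs4 : ((Real.sqrt 2 : ℂ)⁻¹) ^ 4 = 1 / 4 := by
    rw [pow_mul _ 2 2, hs]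
    norm_num
  have hω (k : ℕ) : (ω 8 ^ k) ^ 4 = (-1) ^ k := by
    rw [← pow_mul, mul_comm, pow_mul, ω_eight_pow_four]
  refine ⟨(Real.sqrt 2 : ℂ)⁻¹ * ω 8 ^ 7, (Real.sqrt 2 : ℂ)⁻¹ * ω 8 ^ 5, ?_, ?_, ?_, fun z => ?_⟩
  · rw [mul_pow, hs4, hω]
    norm_num
  · rw [mul_pow, hs4, hω]
    norm_num
  · rw [mul_mul_mul_comm, ← sq, hs, ← pow_add, pow_mul _ 4 3, ω_eight_pow_four]
    norm_num
  · ext i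
    fin_cases i
    · simp [μ, Matrix.mulVec, dotProduct]
      ring
    · simp [μ, Matrix.mulVec, dotProduct]
      linear_combination (Real.sqrt 2 : ℂ)⁻¹ * ω 8 * z 1 * ω_eight_pow_four

lemma eval_σ_eight_mulVec_f6 (z : Fin 2 → ℂ) :
    eval ((σ 8 : Matrix (Fin 2) (Fin 2) ℂ) *ᵥ z) f6 = -eval z f6 := by
  have h : ω 8 * (ω 8)⁻¹ = 1 := mul_inv_cancel₀ (Complex.exp_ne_zero _)
  rw [σ_mulVec, eval_f6, eval_f6]
  simp only [Matrix.cons_val_zero, Matrix.cons_val_one, mul_pow, inv_pow, ω_eight_pow_four,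
    mul_mul_mul_comm (ω 8), h]
  ring

lemma eval_σ_eight_mulVec_f8 (z : Fin 2 → ℂ) :
    eval ((σ 8 : Matrix (Fin 2) (Fin 2) ℂ) *ᵥ z) f8 = eval z f8 := by
  rw [σ_mulVec, eval_f8, eval_f8]
  simp only [Matrix.cons_val_zero, Matrix.cons_val_one, mul_pow, inv_pow, ω_eight_pow_four,
    ω_eight_pow_eight]
  ring

lemma eval_σ_eight_mulVec_f12 (z : Fin 2 → ℂ) :
    eval ((σ 8 : Matrix (Fin 2) (Fin 2) ℂ) *ᵥ z) f12 = -eval z f12 := by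
  have h : ω 8 ^ 12 = -1 := by
    rw [pow_mul _ 4 3, ω_eight_pow_four]
    norm_num
  rw [σ_mulVec, eval_f12, eval_f12]
  simp only [Matrix.cons_val_zero, Matrix.cons_val_one, mul_pow, inv_pow, ω_eight_pow_four,
    ω_eight_pow_eight, h]
  ring

lemma eval_τ_mulVec_f6 (z : Fin 2 → ℂ) :
    eval ((τ : Matrix (Fin 2) (Fin 2) ℂ) *ᵥ z) f6 = eval z f6 := by
  rw [τ_mulVec, eval_f6, eval_f6]
  simp only [Matrix.cons_val_zero, Matrix.cons_val_one]
  ring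

lemma eval_τ_mulVec_f8 (z : Fin 2 → ℂ) :
    eval ((τ : Matrix (Fin 2) (Fin 2) ℂ) *ᵥ z) f8 = eval z f8 := by
  rw [τ_mulVec, eval_f8, eval_f8]
  simp only [Matrix.cons_val_zero, Matrix.cons_val_one]
  ring

lemma eval_τ_mulVec_f12 (z : Fin 2 → ℂ) :
    eval ((τ : Matrix (Fin 2) (Fin 2) ℂ) *ᵥ z) f12 = eval z f12 := by
  rw [τ_mulVec, eval_f12, eval_f12]
  simp only [Matrix.cons_val_zero, Matrix.cons_val_one]
  ring

lemma eval_μ_mulVec_f6 (z : Fin 2 → ℂ) :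
    eval ((μ : Matrix (Fin 2) (Fin 2) ℂ) *ᵥ z) f6 = eval z f6 := by
  obtain ⟨a, c, ha, hc, hac, h⟩ := exists_μ_mulVec
  rw [h, eval_f6, eval_f6]
  simp only [Matrix.cons_val_zero, Matrix.cons_val_one, mul_pow, mul_mul_mul_comm a, ha, hc, hac]
  ring

lemma eval_μ_mulVec_f8 (z : Fin 2 → ℂ) :
    eval ((μ : Matrix (Fin 2) (Fin 2) ℂ) *ᵥ z) f8 = eval z f8 := by
  obtain ⟨a, c, ha, hc, -, h⟩ := exists_μ_mulVec
  rw [h, eval_f8, eval_f8]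
  simp only [Matrix.cons_val_zero, Matrix.cons_val_one, mul_pow, pow_mul a 4 2, pow_mul c 4 2,
    ha, hc]
  ring

lemma eval_μ_mulVec_f12 (z : Fin 2 → ℂ) :
    eval ((μ : Matrix (Fin 2) (Fin 2) ℂ) *ᵥ z) f12 = eval z f12 := by
  obtain ⟨a, c, ha, hc, -, h⟩ := exists_μ_mulVec
  rw [h, eval_f12, eval_f12]
  simp only [Matrix.cons_val_zero, Matrix.cons_val_one, mul_pow, pow_mul a 4 2, pow_mul c 4 2,
    pow_mul a 4 3, pow_mul c 4 3, ha, hc]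
  ring

/-- The polynomials `f₈`, `f₆²` and `f₆·f₁₂` are invariant under the binary octahedral
group `⟨σ₈, τ, μ⟩ ≤ SL₂(ℂ)`. -/
theorem E7_forms_are_invariant :
    ∀ g ∈ Subgroup.closure ({σ 8, τ, μ} : Set SL2), ∀ z : Fin 2 → ℂ,
      MvPolynomial.eval (Matrix.mulVec (↑g : Matrix (Fin 2) (Fin 2) ℂ) z) f8 =
          MvPolynomial.eval z f8 ∧
      MvPolynomial.eval (Matrix.mulVec (↑g : Matrix (Fin 2) (Fin 2) ℂ) z) (f6 ^ 2) =
          MvPolynomial.eval z (f6 ^ 2) ∧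
      MvPolynomial.eval (Matrix.mulVec (↑g : Matrix (Fin 2) (Fin 2) ℂ) z) (f6 * f12) =
          MvPolynomial.eval z (f6 * f12) := by
  intro g hg z
  refine ⟨eval_mulVec_eq_of_mem_closure ?_ hg z, eval_mulVec_eq_of_mem_closure ?_ hg z,
    eval_mulVec_eq_of_mem_closure ?_ hg z⟩
  · rintro s (rfl | rfl | rfl) z
    exacts [eval_σ_eight_mulVec_f8 z, eval_τ_mulVec_f8 z, eval_μ_mulVec_f8 z]
  · rintro s (rfl | rfl | rfl) z
    · rw [map_pow, map_pow, eval_σ_eight_mulVec_f6, neg_sq]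
    · rw [map_pow, map_pow, eval_τ_mulVec_f6]
    · rw [map_pow, map_pow, eval_μ_mulVec_f6]
  · rintro s (rfl | rfl | rfl) z
    · rw [map_mul, map_mul, eval_σ_eight_mulVec_f6, eval_σ_eight_mulVec_f12, neg_mul_neg]
    · rw [map_mul, map_mul, eval_τ_mulVec_f6, eval_τ_mulVec_f12]
    · rw [map_mul, map_mul, eval_μ_mulVec_f6, eval_μ_mulVec_f12]
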